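/- Let n ≥ 1 and let w_0(i), w_1(i) ≥ 0 for i = 1,…,n. Suppose the 2n sub-wedge values are labeled so that n of them are 'type-m' and n are 'type-M', with every type-m value less than or equal to every type-M value. Then there exist a circular permutation σ* of {1,…,n} and an assignment t* ∈ {0,1}^n with AngResl_{σ*,t*} = max over all (σ,t) of AngResl_{σ,t}, such that each of the n angles θ_i in the drawing (σ*,t*) is the sum of one type-m sub-wedge and one type-M sub-wedge. -/

import Mathlib

/-- The cyclic successor `i ⊕ 1` in `Fin n`. -/
def cycSucc {n : ℕ} (i : Fin n) : Fin n :=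
  ⟨(i.val + 1) % n, Nat.mod_lt _ (Nat.lt_of_le_of_lt (Nat.zero_le i.val) i.isLt)⟩

/-- The `i`-th angle `θ_i = w_{t'_i}(σ_i) + w_{t_{i⊕1}}(σ_{i⊕1})` of the balloon drawing
given by circular permutation `σ` and sub-wedge assignment `t` (a `Bool`, with `!t i`
playing the role of `t'_i = 1 − t_i`). -/
noncomputable def theta {n : ℕ} (w : Fin n → Bool → ℝ) (σ : Equiv.Perm (Fin n))
    (t : Fin n → Bool) (i : Fin n) : ℝ :=
  w (σ i) (!t i) + w (σ (cycSucc i)) (t (cycSucc i))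

/-- The angular resolution `AngResl_{σ,t} = min_i θ_i`. -/
noncomputable def angResl {n : ℕ} (w : Fin n → Bool → ℝ) (σ : Equiv.Perm (Fin n))
    (t : Fin n → Bool) : ℝ :=
  sInf (Set.range (theta w σ t))

theorem cycSucc_val {n : ℕ} (i : Fin n) :
    (cycSucc i).val = if i.val + 1 = n then 0 else i.val + 1 := by
  have h := i.isLt
  split_ifs with h1
  · simp [cycSucc, h1]
  · exact Nat.mod_eq_of_lt (by omega)

theorem cycSucc_bijective (n : ℕ) : Function.Bijective (cycSucc : Fin n → Fin n) := by
  refine Finite.injective_iff_bijective.mp fun i j h => ?_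
  have h' := congrArg Fin.val h
  rw [cycSucc_val, cycSucc_val] at h'
  ext
  split_ifs at h' <;> omega

/-- The first sub-wedge `(child, side)` of the `i`-th angle. -/
def fstWedge {n : ℕ} (σ : Equiv.Perm (Fin n)) (t : Fin n → Bool) (i : Fin n) : Fin n × Bool :=
  (σ i, !t i)

/-- The second sub-wedge `(child, side)` of the `i`-th angle. -/
def sndWedge {n : ℕ} (σ : Equiv.Perm (Fin n)) (t : Fin n → Bool) (i : Fin n) : Fin n × Bool :=
  (σ (cycSucc i), t (cycSucc i))

/-- The involution of `Fin n` reversing the half-open segment `(p, q]`. -/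
def revSegment {n : ℕ} (p q k : Fin n) : Fin n :=
  if h : p < k ∧ k ≤ q then ⟨p + 1 + q - k, by have := q.isLt; omega⟩ else k

theorem revSegment_val {n : ℕ} (p q k : Fin n) :
    (revSegment p q k).val =
      if p.val < k.val ∧ k.val ≤ q.val then p.val + 1 + q.val - k.val else k.val := by
  unfold revSegment
  simp only [Fin.lt_def, Fin.le_def]
  split_ifs <;> rfl

theorem revSegment_involutive {n : ℕ} (p q : Fin n) : Function.Involutive (revSegment p q) := by
  intro k
  ext
  simp only [revSegment_val]
  split_ifs <;> omega

/-- The involution of `Fin n` reversing the open segment `(p, q)`. -/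
def revInterior {n : ℕ} (p q k : Fin n) : Fin n :=
  if h : p < k ∧ k < q then ⟨p + q - k, by have := q.isLt; omega⟩ else k

theorem revInterior_val {n : ℕ} (p q k : Fin n) :
    (revInterior p q k).val =
      if p.val < k.val ∧ k.val < q.val then p.val + q.val - k.val else k.val := by
  unfold revInterior
  simp only [Fin.lt_def]
  split_ifs <;> rfl

theorem revInterior_involutive {n : ℕ} (p q : Fin n) :
    Function.Involutive (revInterior p q) := by
  intro k
  ext
  simp only [revInterior_val]
  split_ifs <;> omega

/-- Reversing the part of a drawing between the angles `p` and `q` recombines the sub-wedges of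
these two angles and only permutes the other angles. -/
theorem exists_reversal {n : ℕ} (σ : Equiv.Perm (Fin n)) (t : Fin n → Bool) {p q : Fin n}
    (hpq : p < q) :
    ∃ (σ' : Equiv.Perm (Fin n)) (t' : Fin n → Bool),
      (fstWedge σ' t' p = fstWedge σ t p ∧ sndWedge σ' t' p = fstWedge σ t q) ∧
      (fstWedge σ' t' q = sndWedge σ t p ∧ sndWedge σ' t' q = sndWedge σ t q) ∧
      ∀ k, k ≠ p → k ≠ q →
        (fstWedge σ' t' k = fstWedge σ t (revInterior p q k) ∧
          sndWedge σ' t' k = sndWedge σ t (revInterior p q k)) ∨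
        (fstWedge σ' t' k = sndWedge σ t (revInterior p q k) ∧
          sndWedge σ' t' k = fstWedge σ t (revInterior p q k)) := by
  have hlt : p.val < q.val := hpq
  have hq := q.isLt
  let σ' : Equiv.Perm (Fin n) := (revSegment_involutive p q).toPerm.trans σ
  let t' : Fin n → Bool := fun k => if p < k ∧ k ≤ q then !t (revSegment p q k) else t k
  have inside : ∀ k l : Fin n, p.val < k.val → k.val ≤ q.val → l.val + k.val = p.val + 1 + q.val →
      σ' k = σ l ∧ t' k = !t l := by
    intro k l h1 h2 h3
    have e : revSegment p q k = l := by
      ext; rw [revSegment_val, if_pos ⟨h1, h2⟩]; omega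
    have h : p < k ∧ k ≤ q := ⟨h1, h2⟩
    exact ⟨congrArg σ e, by simp only [t', if_pos h, e]⟩
  have outside : ∀ k : Fin n, k.val ≤ p.val ∨ q.val < k.val → σ' k = σ k ∧ t' k = t k := by
    intro k h1
    have e : revSegment p q k = k := by
      ext; rw [revSegment_val, if_neg (by omega)]
    have h : ¬ (p < k ∧ k ≤ q) := by
      simp only [Fin.lt_def, Fin.le_def]; omega
    exact ⟨congrArg σ e, by simp only [t', if_neg h]⟩
  have sp : (cycSucc p).val = p.val + 1 := by rw [cycSucc_val, if_neg (by omega)]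
  have sq : (cycSucc q).val ≤ p.val ∨ q.val < (cycSucc q).val := by
    rw [cycSucc_val]; split_ifs <;> omega
  refine ⟨σ', t', ⟨?_, ?_⟩, ⟨?_, ?_⟩, ?_⟩
  · obtain ⟨a, b⟩ := outside p (Or.inl le_rfl)
    simp [fstWedge, a, b]
  · obtain ⟨a, b⟩ := inside (cycSucc p) q (by omega) (by omega) (by omega)
    simp [fstWedge, sndWedge, a, b]
  · obtain ⟨a, b⟩ := inside q (cycSucc p) (by omega) (by omega) (by omega)
    simp [fstWedge, sndWedge, a, b]
  · obtain ⟨a, b⟩ := outside (cycSucc q) sq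
    simp [sndWedge, a, b]
  · intro k hkp hkq
    have hkp' : k.val ≠ p.val := fun h => hkp (Fin.ext h)
    have hkq' : k.val ≠ q.val := fun h => hkq (Fin.ext h)
    have hρ := revInterior_val p q k
    have hk := cycSucc_val k
    have hs := cycSucc_val (revInterior p q k)
    by_cases hin : p.val < k.val ∧ k.val < q.val
    · right
      rw [if_pos hin] at hρ
      rw [if_neg (by omega)] at hk hs
      obtain ⟨a, b⟩ := inside k (cycSucc (revInterior p q k)) (by omega) (by omega) (by omega)
      obtain ⟨c, d⟩ := inside (cycSucc k) (revInterior p q k) (by omega) (by omega) (by omega)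
      simp [fstWedge, sndWedge, a, b, c, d]
    · left
      rw [if_neg hin] at hρ
      have e : revInterior p q k = k := Fin.ext hρ
      obtain ⟨a, b⟩ := outside k (by omega)
      obtain ⟨c, d⟩ := outside (cycSucc k) (by rw [hk]; split_ifs <;> omega)
      simp [fstWedge, sndWedge, a, b, c, d, e]

theorem sum_fstWedge_add_sndWedge {n : ℕ} (σ : Equiv.Perm (Fin n)) (t : Fin n → Bool)
    (g : Fin n × Bool → ℕ) :
    ∑ i, (g (fstWedge σ t i) + g (sndWedge σ t i)) = ∑ x, g x := by
  rw [Finset.sum_add_distrib]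
  have h : ∑ i, g (sndWedge σ t i) = ∑ i, g (σ i, t i) :=
    (cycSucc_bijective n).sum_comp fun i => g (σ i, t i)
  rw [h, ← Finset.sum_add_distrib, Fintype.sum_prod_type,
    ← Equiv.sum_comp σ fun i => ∑ b, g (i, b)]
  refine Finset.sum_congr rfl fun i _ => ?_
  cases hb : t i <;> simp [fstWedge, hb, add_comm]

/-- If some angle has two sub-wedges of the same type, then, the two types being equally
frequent, there are both an angle with two type-m and one with two type-M sub-wedges. -/
theorem exists_mono_angles {n : ℕ} (τ : Fin n × Bool → Bool)
    (hcard : (Finset.univ.filter fun x => τ x = false).card = n)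
    (σ : Equiv.Perm (Fin n)) (t : Fin n → Bool)
    {i : Fin n} (hi : τ (fstWedge σ t i) = τ (sndWedge σ t i)) (b : Bool) :
    ∃ j, τ (fstWedge σ t j) = b ∧ τ (sndWedge σ t j) = b := by
  have hsum := sum_fstWedge_add_sndWedge σ t fun x => if τ x = false then 1 else 0
  rw [← Finset.card_filter, hcard] at hsum
  have hn : ∑ _i : Fin n, 1 = n := by simp
  by_contra! hno
  by_cases hib : τ (fstWedge σ t i) = b
  · exact hno i hib (hi ▸ hib)
  replace hsum := hsum.trans hn.symm
  cases b
  · refine (Finset.sum_lt_sum (fun j _ => ?_) ⟨i, Finset.mem_univ i, ?_⟩).ne hsum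
    · have := hno j
      grind
    · grind
  · refine (Finset.sum_lt_sum (fun j _ => ?_) ⟨i, Finset.mem_univ i, ?_⟩).ne' hsum
    · have := hno j
      grind
    · grind

/-- The angles of a drawing both of whose sub-wedges have the same type. -/
def monoAngles {n : ℕ} (τ : Fin n × Bool → Bool) (σ : Equiv.Perm (Fin n)) (t : Fin n → Bool) :
    Finset (Fin n) :=
  Finset.univ.filter fun i => τ (fstWedge σ t i) = τ (sndWedge σ t i)

theorem angResl_le_theta {n : ℕ} (w : Fin n → Bool → ℝ) (σ : Equiv.Perm (Fin n))
    (t : Fin n → Bool) (i : Fin n) : angResl w σ t ≤ theta w σ t i :=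
  csInf_le (Set.finite_range _).bddBelow ⟨i, rfl⟩

theorem theta_eq {n : ℕ} (w : Fin n → Bool → ℝ) (σ : Equiv.Perm (Fin n))
    (t : Fin n → Bool) (i : Fin n) :
    theta w σ t i = Function.uncurry w (fstWedge σ t i) + Function.uncurry w (sndWedge σ t i) :=
  rfl

/-- A drawing with an angle of two sub-wedges of the same type can be changed into one with fewer
such angles without decreasing the angular resolution. -/
theorem exists_fewer_monoAngles {n : ℕ} (w : Fin n → Bool → ℝ) (τ : Fin n × Bool → Bool)
    (hcard : (Finset.univ.filter fun x => τ x = false).card = n)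
    (hsep : ∀ x y, τ x = false → τ y = true → Function.uncurry w x ≤ Function.uncurry w y)
    (σ : Equiv.Perm (Fin n)) (t : Fin n → Bool) (h : (monoAngles τ σ t).Nonempty) :
    ∃ σ' t', angResl w σ t ≤ angResl w σ' t' ∧
      (monoAngles τ σ' t').card < (monoAngles τ σ t).card := by
  obtain ⟨i, hi⟩ := h
  have hi' := (Finset.mem_filter.mp hi).2
  have : Nonempty (Fin n) := ⟨i⟩
  obtain ⟨a, ha⟩ := exists_mono_angles τ hcard σ t hi' false
  obtain ⟨c, hc⟩ := exists_mono_angles τ hcard σ t hi' true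
  obtain ⟨p, q, b, hpq, hp, hq⟩ : ∃ p q b, p < q ∧
      (τ (fstWedge σ t p) = b ∧ τ (sndWedge σ t p) = b) ∧
      (τ (fstWedge σ t q) = !b ∧ τ (sndWedge σ t q) = !b) := by
    rcases lt_trichotomy a c with h | h | h
    · exact ⟨a, c, false, h, ha, hc⟩
    · subst h; simp [ha.1] at hc
    · exact ⟨c, a, true, h, hc, ha⟩
  obtain ⟨σ', t', ⟨p1, p2⟩, ⟨q1, q2⟩, hk⟩ := exists_reversal σ t hpq
  have hpm : p ∈ monoAngles τ σ t := by simp [monoAngles, hp]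
  refine ⟨σ', t', ?_, ?_⟩
  · refine le_csInf (Set.range_nonempty _) ?_
    rintro _ ⟨k, rfl⟩
    have hθp := angResl_le_theta w σ t p
    have hθq := angResl_le_theta w σ t q
    have hθk := angResl_le_theta w σ t (revInterior p q k)
    rw [theta_eq] at hθp hθq hθk ⊢
    by_cases hkp : k = p
    · subst hkp
      rw [p1, p2]
      cases b
      · linarith [hsep _ _ hp.2 hq.1]
      · linarith [hsep _ _ hq.2 hp.1]
    by_cases hkq : k = q
    · subst hkq
      rw [q1, q2]
      cases b
      · linarith [hsep _ _ hp.1 hq.2]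
      · linarith [hsep _ _ hq.1 hp.2]
    rcases hk k hkp hkq with ⟨e, f⟩ | ⟨e, f⟩ <;> rw [e, f] <;> linarith
  · refine lt_of_le_of_lt ?_ (Finset.card_erase_lt_of_mem hpm)
    refine Finset.card_le_card_of_injOn (revInterior p q) (fun k hkm => ?_)
      (revInterior_involutive p q).injective.injOn
    have hkm' := (Finset.mem_filter.mp hkm).2
    have hkp : k ≠ p := by
      rintro rfl
      rw [p1, p2, hp.1, hq.1] at hkm'
      simp at hkm'
    have hkq : k ≠ q := by
      rintro rfl
      rw [q1, q2, hp.2, hq.2] at hkm'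
      simp at hkm'
    refine Finset.mem_erase.mpr ⟨fun e => hkp ?_, ?_⟩
    · rw [← revInterior_involutive p q k, e]
      ext
      simp [revInterior_val]
    · rw [monoAngles, Finset.mem_filter]
      rcases hk k hkp hkq with ⟨e, f⟩ | ⟨e, f⟩ <;> rw [e, f] at hkm' <;> simp [hkm']

/-- Observation 1 for RE4: if the `2n` sub-wedges are labeled by `τ` with `n` of them of
type-m (`τ = false`) and `n` of type-M (`τ = true`), every type-m value being at most every
type-M value, then some drawing `(σ, t)` maximizing the angular resolution has every angle
made of one type-m and one type-M sub-wedge. -/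
theorem RE4_alternating_optimum (n : ℕ) (hn : 1 ≤ n) (w : Fin n → Bool → ℝ)
    (hw : ∀ i b, 0 ≤ w i b) (τ : Fin n → Bool → Bool)
    (hcard : (Finset.univ.filter fun p : Fin n × Bool => τ p.1 p.2 = false).card = n)
    (hsep : ∀ p q : Fin n × Bool, τ p.1 p.2 = false → τ q.1 q.2 = true →
      w p.1 p.2 ≤ w q.1 q.2) :
    ∃ (σ : Equiv.Perm (Fin n)) (t : Fin n → Bool),
      (∀ (σ' : Equiv.Perm (Fin n)) (t' : Fin n → Bool), angResl w σ' t' ≤ angResl w σ t) ∧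
      ∀ i : Fin n, τ (σ i) (!t i) ≠ τ (σ (cycSucc i)) (t (cycSucc i)) := by
  let τ' : Fin n × Bool → Bool := Function.uncurry τ
  have : Nonempty (Fin n) := ⟨⟨0, hn⟩⟩
  obtain ⟨⟨σ₀, t₀⟩, hmax⟩ := Finite.exists_max
    fun d : Equiv.Perm (Fin n) × (Fin n → Bool) => angResl w d.1 d.2
  let D := {d : Equiv.Perm (Fin n) × (Fin n → Bool) // angResl w σ₀ t₀ ≤ angResl w d.1 d.2}
  have : Nonempty D := ⟨⟨(σ₀, t₀), le_rfl⟩⟩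
  obtain ⟨⟨⟨σ, t⟩, hopt⟩, hmin⟩ := Finite.exists_min
    fun d : D => (monoAngles τ' d.1.1 d.1.2).card
  refine ⟨σ, t, fun σ' t' => (hmax (σ', t')).trans hopt, fun i hi => ?_⟩
  obtain ⟨σ', t', hle, hlt⟩ := exists_fewer_monoAngles w τ' hcard hsep σ t
    ⟨i, Finset.mem_filter.mpr ⟨Finset.mem_univ i, hi⟩⟩
  exact hlt.not_ge (hmin ⟨(σ', t'), hopt.trans hle⟩)
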